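/- (Tightness of the ℓ1 recovery bound, valid convolution) If k > 1 divides n, then there exist x, x' ∈ ℝⁿ with x ≠ x', |supp(x)| = n/k, Ax' = Ax, and ‖x'‖₁ = ‖x‖₁; in particular, x is not the unique ℓ1-norm minimizer among solutions of Aw = Ax. -/

import Mathlib

/-- Valid convolution with a box of width `k`: `(A x)_i = ∑_{t=0}^{k-1} x_{i+t}`. -/
def boxA (n k : ℕ) (x : Fin n → ℝ) : Fin (n - k + 1) → ℝ :=
  fun i => ∑ j : Fin n, if (i : ℕ) ≤ (j : ℕ) ∧ (j : ℕ) < (i : ℕ) + k then x j else 0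

/-- Every box of width `k` inside `{0, …, n-1}` meets each residue class mod `k` exactly once. -/
lemma boxA_residue_indicator {n k r : ℕ} (hn : k ≤ n) (hr : r < k) (i : Fin (n - k + 1)) :
    boxA n k (fun j => if (j : ℕ) ≡ r [MOD k] then 1 else 0) i = 1 := by
  have hper : Function.Periodic (· ≡ r [MOD k]) k := fun j => by simp [Nat.ModEq]
  have hcount : ((Finset.Ico (i : ℕ) (i + k)).filter (· ≡ r [MOD k])).card = 1 := by
    rw [Nat.filter_Ico_card_eq_of_periodic _ _ _ hper, Nat.count_modEq_card _ (by omega),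
      Nat.div_self (by omega)]
    simp
  have hIco : (Finset.range n).filter (fun j => (i : ℕ) ≤ j ∧ j < i + k)
      = Finset.Ico (i : ℕ) (i + k) := by
    ext j
    have := i.isLt
    simp only [Finset.mem_filter, Finset.mem_range, Finset.mem_Ico]
    omega
  unfold boxA
  rw [Fin.sum_univ_eq_sum_range (fun j => if (i : ℕ) ≤ j ∧ j < i + k then
      (if j ≡ r [MOD k] then (1 : ℝ) else 0) else 0) n, ← Finset.sum_filter, hIco,
    Finset.sum_boole, hcount, Nat.cast_one]

/-- If `k` divides `n`, each residue class mod `k` has `n / k` elements in `{0, …, n-1}`. -/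
lemma card_filter_fin_modEq {n k : ℕ} (r : ℕ) (hk : 0 < k) (hdvd : k ∣ n) :
    (Finset.univ.filter fun j : Fin n => (j : ℕ) ≡ r [MOD k]).card = n / k := by
  rw [Finset.card_filter, Fin.sum_univ_eq_sum_range (fun j => if j ≡ r [MOD k] then 1 else 0) n,
    ← Finset.card_filter, ← Nat.count_eq_card_filter_range, Nat.count_modEq_card _ hk,
    Nat.mod_eq_zero_of_dvd hdvd]
  simp

/-- Tightness of the `ℓ1` recovery bound for the valid convolution: if `k > 1` divides `n`,
there are distinct `x, x'` with `|supp(x)| = n/k`, `A x' = A x` and `‖x'‖₁ = ‖x‖₁`. -/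
theorem boxA_l1_bound_tight (n k : ℕ) (hk : 1 < k) (hn : k ≤ n) (hdvd : k ∣ n) :
    ∃ x x' : Fin n → ℝ, x ≠ x' ∧
      (Finset.univ.filter fun j => x j ≠ 0).card = n / k ∧
      boxA n k x' = boxA n k x ∧
      ∑ j, |x' j| = ∑ j, |x j| := by
  have hnorm (r : ℕ) :
      ∑ j : Fin n, |if (j : ℕ) ≡ r [MOD k] then (1 : ℝ) else 0| = (n / k : ℕ) := by
    simp_rw [apply_ite abs, abs_one, abs_zero]
    rw [Finset.sum_boole, card_filter_fin_modEq r (by omega) hdvd]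
  refine ⟨fun j => if (j : ℕ) ≡ 0 [MOD k] then 1 else 0,
    fun j => if (j : ℕ) ≡ 1 [MOD k] then 1 else 0, fun h => ?_, ?_, ?_, ?_⟩
  · have h0 := congrFun h ⟨0, by omega⟩
    simp [Nat.ModEq, Nat.mod_eq_of_lt hk] at h0
  · simpa using card_filter_fin_modEq 0 (by omega) hdvd
  · funext i
    rw [boxA_residue_indicator hn hk, boxA_residue_indicator hn (by omega)]
  · exact (hnorm 1).trans (hnorm 0).symm
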